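/- arXiv:1209.1180 — 6 statements merged into one kernel-verified Lean document; each statement's English description precedes it below -/
import Mathlib

section
/- S-Procedure: Let A, D be n×n complex Hermitian matrices, b ∈ ℂⁿ, and c, e ∈ ℝ. Assume the interior condition holds, i.e., there exists a vector x̄ ∈ ℂⁿ with x̄^H D x̄ < e. Then the implication ‘for every x ∈ ℂⁿ with x^H D x ≤ e one has x^H A x + 2·Re(b^H x) + c ≥ 0’ holds if and only if there exists θ ≥ 0 such that the (n+1)×(n+1) block matrix [[θD + A, b], [b^H, c − eθ]] is Hermitian positive semidefinite. -/
open Matrix ComplexOrder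

/-- The real quadratic form `x ↦ Re (xᴴ M x)` of a complex square matrix. -/
noncomputable def reQuadForm {m : Type*} [Fintype m] (M : Matrix m m ℂ) :
    QuadraticForm ℝ (m → ℂ) :=
  LinearMap.BilinMap.toQuadraticMap
    (LinearMap.mk₂ ℝ (fun x y : m → ℂ => (star x ⬝ᵥ M *ᵥ y).re)
      (fun x y z => by simp [add_dotProduct])
      (fun r x y => by simp [smul_dotProduct])
      (fun x y z => by simp [mulVec_add, dotProduct_add])
      (fun r x y => by simp [mulVec_smul, dotProduct_smul]))

theorem reQuadForm_apply {m : Type*} [Fintype m] (M : Matrix m m ℂ) (x : m → ℂ) :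
    reQuadForm M x = (star x ⬝ᵥ M *ᵥ x).re := rfl

theorem reQuadForm_complex_smul {m : Type*} [Fintype m] (M : Matrix m m ℂ) (z : ℂ)
    (x : m → ℂ) : reQuadForm M (z • x) = Complex.normSq z * reQuadForm M x := by
  have h : star z * z = (Complex.normSq z : ℂ) := Complex.normSq_eq_conj_mul_self.symm
  simp only [reQuadForm_apply, star_smul, mulVec_smul, dotProduct_smul, smul_dotProduct,
    smul_eq_mul]
  rw [← mul_assoc, mul_comm z, h, Complex.re_ofReal_mul]

theorem Matrix.IsHermitian.posSemidef_iff_reQuadForm {m : Type*} [Fintype m]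
    {M : Matrix m m ℂ} (hM : M.IsHermitian) :
    M.PosSemidef ↔ ∀ x, 0 ≤ reQuadForm M x := by
  rw [posSemidef_iff_dotProduct_mulVec]
  refine ⟨fun h x => (Complex.le_def.1 (h.2 x)).1, fun h => ⟨hM, fun x => ?_⟩⟩
  exact Complex.le_def.2 ⟨h x, (hM.im_star_dotProduct_mulVec_self x).symm⟩

theorem QuadraticMap.map_add_smul_eq {V : Type*} [AddCommGroup V] [Module ℝ V]
    (Q : QuadraticForm ℝ V) (v w : V) (t : ℝ) :
    Q (v + t • w) = Q v + t * polar Q v w + t ^ 2 * Q w := by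
  rw [QuadraticMap.map_add Q, QuadraticMap.map_smul, QuadraticMap.polar_smul_right]
  simp only [smul_eq_mul]
  ring

theorem nonneg_of_forall_pos_quadratic_nonneg {a p q : ℝ}
    (h : ∀ t : ℝ, 0 < t → 0 ≤ a + t * p + t ^ 2 * q) : 0 ≤ a := by
  have hc : Continuous fun t : ℝ => a + t * p + t ^ 2 * q := by fun_prop
  have ht : Filter.Tendsto (fun t : ℝ => a + t * p + t ^ 2 * q)
      (nhdsWithin 0 (Set.Ioi 0)) (nhds a) := by
    simpa using (hc.tendsto 0).mono_left nhdsWithin_le_nhds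
  exact ge_of_tendsto ht (Filter.eventually_of_mem self_mem_nhdsWithin h)

/-- Nonnegativity of `F` along nonzero translates by `w` with `G < 0` passes to the limit. -/
theorem QuadraticForm.nonneg_of_nonneg_on_neg {V : Type*} [AddCommGroup V] [Module ℝ V]
    (F G : QuadraticForm ℝ V) {v w : V} (hv : G v ≤ 0) (hw : G w < 0)
    (h : ∀ t : ℝ, t ≠ 0 → G (v + t • w) ≤ 0 → 0 ≤ F (v + t • w)) : 0 ≤ F v := by
  rcases le_total (QuadraticMap.polar G v w) 0 with hp | hp
  · refine nonneg_of_forall_pos_quadratic_nonneg (p := QuadraticMap.polar F v w) (q := F w)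
      fun t ht => ?_
    rw [← QuadraticMap.map_add_smul_eq]
    refine h t ht.ne' ?_
    rw [QuadraticMap.map_add_smul_eq]
    nlinarith [mul_nonneg ht.le (neg_nonneg.2 hp), mul_nonneg (sq_nonneg t) (neg_nonneg.2 hw.le)]
  · refine nonneg_of_forall_pos_quadratic_nonneg (p := -QuadraticMap.polar F v w) (q := F w)
      fun t ht => ?_
    have key := h (-t) (neg_ne_zero.2 ht.ne') (by
      rw [QuadraticMap.map_add_smul_eq]
      nlinarith [mul_nonneg ht.le hp, mul_nonneg (sq_nonneg t) (neg_nonneg.2 hw.le)])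
    rw [QuadraticMap.map_add_smul_eq] at key
    linarith

theorem exists_pos_roots_of_opposite_signs {g k : ℝ} (p : ℝ) (hg : 0 < g) (hk : 0 < k) :
    ∃ r s : ℝ, 0 < r ∧ 0 < s ∧ g * (r * s) = k ∧
      k + r * p - r ^ 2 * g = 0 ∧ k - s * p - s ^ 2 * g = 0 := by
  have hd : 0 < g * k := mul_pos hg hk
  have hsq : √(p ^ 2 + 4 * (g * k)) ^ 2 = p ^ 2 + 4 * (g * k) := Real.sq_sqrt (by positivity)
  have habs : |p| < √(p ^ 2 + 4 * (g * k)) := by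
    refine abs_lt_of_sq_lt_sq ?_ (Real.sqrt_nonneg _)
    rw [hsq]
    linarith
  set d := √(p ^ 2 + 4 * (g * k))
  obtain ⟨h1, h2⟩ := abs_lt.1 habs
  refine ⟨(d + p) / (2 * g), (d - p) / (2 * g), by apply div_pos <;> linarith,
    by apply div_pos <;> linarith, ?_, ?_, ?_⟩
  all_goals
    field_simp
    linarith

/-- The homogeneous S-lemma for real quadratic forms. -/
theorem QuadraticForm.exists_nonneg_add_mul {V : Type*} [AddCommGroup V] [Module ℝ V]
    (F G : QuadraticForm ℝ V) (hneg : ∃ w, G w < 0) (h : ∀ v, G v ≤ 0 → 0 ≤ F v) :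
    ∃ θ : ℝ, 0 ≤ θ ∧ ∀ v, 0 ≤ F v + θ * G v := by
  have cross : ∀ v w, 0 < G v → G w < 0 → 0 ≤ F v * (-G w) + F w * G v := by
    intro v w hv hw
    obtain ⟨r, s, hr, hs, hrs, h1, h2⟩ := exists_pos_roots_of_opposite_signs
      (QuadraticMap.polar G v w) (neg_pos.2 hw) hv
    have k1 := h (v + r • w) (by rw [QuadraticMap.map_add_smul_eq]; linarith)
    have k2 := h (v + (-s) • w) (by rw [QuadraticMap.map_add_smul_eq]; linarith)
    rw [QuadraticMap.map_add_smul_eq] at k1 k2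
    have k3 : 0 ≤ (r + s) * (F v + r * s * F w) := by
      linarith [mul_nonneg hs.le k1, mul_nonneg hr.le k2]
    have k4 := nonneg_of_mul_nonneg_right k3 (by positivity)
    rw [← hrs]
    linarith [mul_nonneg (neg_nonneg.2 hw.le) k4]
  let S : Set ℝ := {x | ∃ w, G w < 0 ∧ F w / -G w = x}
  have hS : S.Nonempty := hneg.imp' (fun w => F w / -G w) fun w hw => ⟨w, hw, rfl⟩
  have hS0 : ∀ x ∈ S, 0 ≤ x := by
    rintro _ ⟨w, hw, rfl⟩
    exact div_nonneg (h w hw.le) (neg_nonneg.2 hw.le)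
  refine ⟨sInf S, le_csInf hS hS0, fun v => ?_⟩
  rcases lt_trichotomy (G v) 0 with hv | hv | hv
  · have := csInf_le ⟨0, hS0⟩ (show F v / -G v ∈ S from ⟨v, hv, rfl⟩)
    rw [le_div_iff₀ (neg_pos.2 hv)] at this
    linarith
  · simpa [hv] using h v hv.le
  · have : -F v / G v ≤ sInf S := by
      refine le_csInf hS ?_
      rintro _ ⟨w, hw, rfl⟩
      rw [div_le_div_iff₀ hv (neg_pos.2 hw)]
      linarith [cross v w hv hw]
    rw [div_le_iff₀ hv] at this
    linarith

/-- The Hermitian bordered matrix `[[A, b], [bᴴ, c]]`. -/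
def bordered {n : ℕ} (A : Matrix (Fin n) (Fin n) ℂ) (b : Fin n → ℂ) (c : ℝ) :
    Matrix (Fin n ⊕ Fin 1) (Fin n ⊕ Fin 1) ℂ :=
  Matrix.fromBlocks A (Matrix.of fun i _ => b i) (Matrix.of fun _ j => star (b j))
    (Matrix.of fun _ _ => (c : ℂ))

theorem bordered_isHermitian {n : ℕ} {A : Matrix (Fin n) (Fin n) ℂ} (hA : A.IsHermitian)
    (b : Fin n → ℂ) (c : ℝ) : (bordered A b c).IsHermitian := by
  refine Matrix.IsHermitian.fromBlocks hA ?_ ?_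
  · ext i j
    simp
  · ext i j
    simp

theorem reQuadForm_bordered {n : ℕ} (A : Matrix (Fin n) (Fin n) ℂ) (b : Fin n → ℂ) (c : ℝ)
    (x : Fin n → ℂ) : reQuadForm (bordered A b c) (Sum.elim x 1) =
      (star x ⬝ᵥ A *ᵥ x).re + 2 * (star b ⬝ᵥ x).re + c := by
  have hx : star (Sum.elim x (1 : Fin 1 → ℂ)) = Sum.elim (star x) 1 := by
    ext i
    cases i <;> simp
  have h1 : (Matrix.of fun i (_ : Fin 1) => b i) *ᵥ 1 = b := by
    ext i
    simp [mulVec, dotProduct]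
  have h2 : (1 : Fin 1 → ℂ) ⬝ᵥ (Matrix.of fun (_ : Fin 1) j => star (b j)) *ᵥ x
      = star b ⬝ᵥ x := by
    simp [mulVec, dotProduct]
  have h3 : (star x ⬝ᵥ b).re = (star b ⬝ᵥ x).re := by
    rw [← Complex.conj_re]
    simp [dotProduct, mul_comm]
  rw [reQuadForm_apply, bordered, fromBlocks_mulVec, hx]
  simp only [sumElim_dotProduct_sumElim, Sum.elim_comp_inl, Sum.elim_comp_inr, dotProduct_add,
    h1, h2, Complex.add_re, h3]
  simp [mulVec, dotProduct]
  ring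

/-- S-Procedure (Lemma 1): given Hermitian `A`, `D`, a vector `b`, reals `c`, `e`,
and the interior condition `∃ x̄, x̄ᴴ D x̄ < e`, the robust quadratic inequality
holds iff there is `θ ≥ 0` making the block matrix `[[θD + A, b], [bᴴ, c − eθ]]` PSD. -/
theorem s_procedure {n : ℕ} (A D : Matrix (Fin n) (Fin n) ℂ)
    (hA : A.IsHermitian) (hD : D.IsHermitian) (b : Fin n → ℂ) (c e : ℝ)
    (hint : ∃ x : Fin n → ℂ, (star x ⬝ᵥ D.mulVec x).re < e) :
    (∀ x : Fin n → ℂ, (star x ⬝ᵥ D.mulVec x).re ≤ e →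
      0 ≤ (star x ⬝ᵥ A.mulVec x).re + 2 * (star b ⬝ᵥ x).re + c) ↔
    ∃ θ : ℝ, 0 ≤ θ ∧
      (Matrix.fromBlocks ((θ : ℂ) • D + A)
        (Matrix.of fun i (_ : Fin 1) => b i)
        (Matrix.of fun (_ : Fin 1) j => star (b j))
        (Matrix.of fun (_ : Fin 1) (_ : Fin 1) => ((c : ℂ) - (e : ℂ) * (θ : ℂ)))).PosSemidef := by
  have hM : ∀ θ : ℝ, Matrix.fromBlocks ((θ : ℂ) • D + A)
        (Matrix.of fun i (_ : Fin 1) => b i)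
        (Matrix.of fun (_ : Fin 1) j => star (b j))
        (Matrix.of fun (_ : Fin 1) (_ : Fin 1) => ((c : ℂ) - (e : ℂ) * (θ : ℂ)))
      = bordered A b c + (θ : ℂ) • bordered D 0 (-e) := by
    intro θ
    ext (i | i) (j | j) <;> simp [bordered] <;> ring
  have hH : ∀ θ : ℝ, (bordered A b c + (θ : ℂ) • bordered D 0 (-e)).IsHermitian := fun θ =>
    (bordered_isHermitian hA b c).add
      ((bordered_isHermitian hD 0 (-e)).smul (Complex.conj_ofReal θ))
  have hQ : ∀ (θ : ℝ) x, reQuadForm (bordered A b c + (θ : ℂ) • bordered D 0 (-e)) x =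
      reQuadForm (bordered A b c) x + θ * reQuadForm (bordered D 0 (-e)) x := by
    intro θ x
    simp only [reQuadForm_apply, add_mulVec, smul_mulVec, dotProduct_add, dotProduct_smul,
      smul_eq_mul, Complex.add_re, Complex.re_ofReal_mul]
  simp only [hM, (hH _).posSemidef_iff_reQuadForm, hQ]
  have hG : ∀ x, reQuadForm (bordered D 0 (-e)) (Sum.elim x 1) =
      (star x ⬝ᵥ D *ᵥ x).re - e := by
    intro x
    simp [reQuadForm_bordered, sub_eq_add_neg]
  constructor
  · intro h
    have affine : ∀ v : Fin n ⊕ Fin 1 → ℂ, v (Sum.inr 0) ≠ 0 →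
        reQuadForm (bordered D 0 (-e)) v ≤ 0 → 0 ≤ reQuadForm (bordered A b c) v := by
      intro v hv hGv
      set z := v (Sum.inr 0) with hz
      have hvz : v = z • Sum.elim (fun i => z⁻¹ * v (Sum.inl i)) 1 := by
        ext (i | i)
        · simp [hv]
        · simp [hz, Subsingleton.elim i 0]
      have hpos : 0 < Complex.normSq z := Complex.normSq_pos.2 hv
      rw [hvz, reQuadForm_complex_smul] at hGv ⊢
      refine mul_nonneg hpos.le ?_
      rw [reQuadForm_bordered]
      refine h _ ?_
      have := nonpos_of_mul_nonpos_right hGv hpos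
      rw [hG] at this
      linarith
    obtain ⟨x₀, hx₀⟩ := hint
    have hw : reQuadForm (bordered D 0 (-e)) (Sum.elim x₀ 1) < 0 := by
      rw [hG]
      linarith
    refine QuadraticForm.exists_nonneg_add_mul _ _ ⟨_, hw⟩ fun v hv => ?_
    by_cases hz : v (Sum.inr 0) = 0
    · refine QuadraticForm.nonneg_of_nonneg_on_neg _ _ hv hw fun t ht => affine _ ?_
      simpa [hz] using ht
    · exact affine v hz hv
  · rintro ⟨θ, hθ, h⟩ x hx
    have := h (Sum.elim x 1)
    rw [hG, reQuadForm_bordered] at this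
    nlinarith [mul_nonneg hθ (sub_nonneg.2 hx)]
end

section
/- Concavity of the per-link utility: Let H be an N×M complex matrix and R an N×N Hermitian positive definite complex matrix. The function u(Q) := Re Tr( H Q H^H (H Q H^H + R)^{-1} ) is concave on the convex set of M×M Hermitian positive semidefinite complex matrices. -/
open Matrix ComplexOrder

namespace Matrix

variable {n : Type*} [Fintype n] [DecidableEq n]

open scoped MatrixOrder Norms.L2Operator in
/-- The trace of a product of two positive semidefinite matrices is nonnegative. -/
theorem PosSemidef.trace_mul_nonneg {A B : Matrix n n ℂ} (hA : A.PosSemidef)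
    (hB : B.PosSemidef) : 0 ≤ (A * B).trace := by
  obtain ⟨S, rfl⟩ := CStarAlgebra.nonneg_iff_eq_star_mul_self.mp hA.nonneg
  rw [star_eq_conjTranspose, Matrix.mul_assoc, trace_mul_comm]
  exact (hB.mul_mul_conjTranspose_same S).trace_nonneg

/-- The tangent inequality for matrix inversion: `A⁻¹` dominates its linearization at `C`. -/
theorem PosDef.posSemidef_inv_sub_tangent {A C : Matrix n n ℂ} (hA : A.PosDef)
    (hC : C.PosDef) : (A⁻¹ - (2 : ℝ) • C⁻¹ + C⁻¹ * A * C⁻¹).PosSemidef := by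
  have hdet : IsUnit A.det := A.isUnit_iff_isUnit_det.mp hA.isUnit
  have h := hA.posSemidef.conjTranspose_mul_mul_same (A⁻¹ - C⁻¹)
  rw [conjTranspose_sub, hA.inv.isHermitian.eq, hC.inv.isHermitian.eq] at h
  convert h using 1
  simp only [sub_mul, mul_sub, nonsing_inv_mul _ hdet, mul_nonsing_inv_cancel_right _ _ hdet,
    one_mul, two_smul]
  abel

/-- Inversion is operator convex on positive definite matrices. -/
theorem PosDef.posSemidef_inv_convex {A B : Matrix n n ℂ} (hA : A.PosDef) (hB : B.PosDef)
    {a b : ℝ} (ha : 0 ≤ a) (hb : 0 ≤ b) (hab : a + b = 1) (hC : (a • A + b • B).PosDef) :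
    (a • A⁻¹ + b • B⁻¹ - (a • A + b • B)⁻¹).PosSemidef := by
  have h := ((hA.posSemidef_inv_sub_tangent hC).smul ha).add
    ((hB.posSemidef_inv_sub_tangent hC).smul hb)
  set C := a • A + b • B with hCdef
  have hdet : IsUnit C.det := C.isUnit_iff_isUnit_det.mp hC.isUnit
  have key : a • (C⁻¹ * A * C⁻¹) + b • (C⁻¹ * B * C⁻¹) = C⁻¹ := by
    calc _ = C⁻¹ * (a • A + b • B) * C⁻¹ := by
          simp only [mul_add, add_mul, mul_smul_comm, smul_mul_assoc]
      _ = C⁻¹ := by rw [← hCdef, nonsing_inv_mul _ hdet, one_mul]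
  convert h using 1
  obtain rfl : b = 1 - a := by linarith
  calc _ = a • A⁻¹ + (1 - a) • B⁻¹ - (2 : ℝ) • C⁻¹ + C⁻¹ := by module
    _ = a • A⁻¹ + (1 - a) • B⁻¹ - (2 : ℝ) • C⁻¹
        + (a • (C⁻¹ * A * C⁻¹) + (1 - a) • (C⁻¹ * B * C⁻¹)) := by rw [key]
    _ = _ := by module

end Matrix

/-- Concavity of the per-link utility
`u(Q) = Re Tr(H Q Hᴴ (H Q Hᴴ + R)⁻¹)` on the convex set of PSD matrices. -/
theorem per_link_utility_concave {N M : ℕ} (H : Matrix (Fin N) (Fin M) ℂ)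
    (R : Matrix (Fin N) (Fin N) ℂ) (hR : R.PosDef) :
    ConcaveOn ℝ {Q : Matrix (Fin M) (Fin M) ℂ | Q.PosSemidef}
      (fun Q => ((H * Q * Hᴴ * (H * Q * Hᴴ + R)⁻¹).trace).re) := by
  have hconv : Convex ℝ {Q : Matrix (Fin M) (Fin M) ℂ | Q.PosSemidef} :=
    fun X hX Y hY a b ha hb _ => (hX.smul ha).add (hY.smul hb)
  have hK {Q : Matrix (Fin M) (Fin M) ℂ} (hQ : Q.PosSemidef) : (H * Q * Hᴴ + R).PosDef :=
    hR.posSemidef_add (hQ.mul_mul_conjTranspose_same H)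
  have hu {Q : Matrix (Fin M) (Fin M) ℂ} (hQ : Q.PosSemidef) :
      ((H * Q * Hᴴ * (H * Q * Hᴴ + R)⁻¹).trace).re
        = N - ((R * (H * Q * Hᴴ + R)⁻¹).trace).re := by
    have hdet := (H * Q * Hᴴ + R).isUnit_iff_isUnit_det.mp (hK hQ).isUnit
    have h := congrArg (fun X => X.trace.re) (mul_nonsing_inv _ hdet)
    simp only [add_mul, trace_add, Complex.add_re, trace_one, Fintype.card_fin,
      Complex.natCast_re] at h
    linarith
  refine ⟨hconv, fun X hX Y hY a b ha hb hab => ?_⟩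
  have hZ := hconv hX hY ha hb hab
  have hlin : H * (a • X + b • Y) * Hᴴ + R
      = a • (H * X * Hᴴ + R) + b • (H * Y * Hᴴ + R) := by
    have hRab : R = a • R + b • R := by rw [← add_smul, hab, one_smul]
    conv_lhs => rw [hRab]
    simp only [Matrix.mul_add, Matrix.add_mul, Matrix.mul_smul, Matrix.smul_mul, smul_add]
    abel
  have hp := (hK hX).posSemidef_inv_convex (hK hY) ha hb hab (hlin ▸ hK hZ)
  have h := (Complex.le_def.mp (hR.posSemidef.trace_mul_nonneg hp)).1
  rw [← hlin] at h
  simp only [mul_add, mul_sub, mul_smul_comm, trace_add, trace_sub, trace_smul, Complex.zero_re,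
    Complex.sub_re, Complex.add_re, Complex.smul_re, smul_eq_mul] at h
  simp only [hu hX, hu hY, hu hZ, smul_eq_mul]
  obtain rfl : b = 1 - a := by linarith
  linarith
end

section
/- Convexity of the coupling term (Lemma 2, function part): Let H be an N×M complex matrix, V an N×N Hermitian positive semidefinite complex matrix, and R₀ an N×N Hermitian positive definite complex matrix. The function f(Q) := Re Tr( V (H Q H^H + R₀)^{-1} ) is convex on the convex set of M×M Hermitian positive semidefinite complex matrices. -/
open Matrix ComplexOrder

/-- The matrix inverse is operator convex on positive definite matrices. -/
lemma Matrix.PosDef.posSemidef_inv_convex_s8 {n : Type*} [Fintype n] [DecidableEq n]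
    {A B : Matrix n n ℂ} (hA : A.PosDef) (hB : B.PosDef) {a b : ℝ}
    (ha : 0 ≤ a) (hb : 0 ≤ b) (hab : a + b = 1) (hC : (a • A + b • B).PosDef) :
    (a • A⁻¹ + b • B⁻¹ - (a • A + b • B)⁻¹).PosSemidef := by
  have block {X : Matrix n n ℂ} (hX : X.PosDef) : (fromBlocks X 1 1ᴴ X⁻¹).PosSemidef := by
    have := hX.isUnit.invertible
    rw [Matrix.PosDef.fromBlocks₁₁ _ _ hX]
    simpa using Matrix.PosSemidef.zero
  have key := ((block hA).smul ha).add ((block hB).smul hb)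
  rw [fromBlocks_smul, fromBlocks_smul, fromBlocks_add, conjTranspose_one, ← add_smul, hab,
    one_smul] at key
  have := hC.isUnit.invertible
  nth_rw 2 [← conjTranspose_one] at key
  rw [Matrix.PosDef.fromBlocks₁₁ _ _ hC] at key
  simpa using key

/-- The trace of a product of two positive semidefinite matrices has nonnegative real part. -/
lemma Matrix.PosSemidef.re_trace_mul_nonneg {n : Type*} [Fintype n] [DecidableEq n]
    {V X : Matrix n n ℂ} (hV : V.PosSemidef) (hX : X.PosSemidef) :
    0 ≤ (V * X).trace.re := by
  open scoped MatrixOrder in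
  obtain ⟨B, rfl⟩ := CStarAlgebra.nonneg_iff_eq_star_mul_self.mp hV.nonneg
  rw [star_eq_conjTranspose, Matrix.mul_assoc, trace_mul_comm]
  exact (Complex.le_def.mp (hX.mul_mul_conjTranspose_same B).trace_nonneg).1

/-- Convexity of the coupling term (Lemma 2, function part):
`f(Q) = Re Tr(V (H Q Hᴴ + R₀)⁻¹)` is convex on the set of PSD matrices. -/
theorem coupling_term_convex {N M : ℕ} (H : Matrix (Fin N) (Fin M) ℂ)
    (V : Matrix (Fin N) (Fin N) ℂ) (hV : V.PosSemidef)
    (R₀ : Matrix (Fin N) (Fin N) ℂ) (hR₀ : R₀.PosDef) :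
    ConvexOn ℝ {Q : Matrix (Fin M) (Fin M) ℂ | Q.PosSemidef}
      (fun Q => ((V * (H * Q * Hᴴ + R₀)⁻¹).trace).re) := by
  have hconv : Convex ℝ {Q : Matrix (Fin M) (Fin M) ℂ | Q.PosSemidef} :=
    fun P hP Q hQ a b ha hb _ => (PosSemidef.smul hP ha).add (PosSemidef.smul hQ hb)
  refine ⟨hconv, fun P hP Q hQ a b ha hb hab => ?_⟩
  have pos {Q : Matrix (Fin M) (Fin M) ℂ} (hQ : Q.PosSemidef) : (H * Q * Hᴴ + R₀).PosDef :=
    PosDef.posSemidef_add (hQ.mul_mul_conjTranspose_same H) hR₀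
  have hcomb : H * (a • P + b • Q) * Hᴴ + R₀ =
      a • (H * P * Hᴴ + R₀) + b • (H * Q * Hᴴ + R₀) := by
    rw [smul_add, smul_add, add_add_add_comm, ← add_smul, hab, one_smul]
    simp [Matrix.mul_add, Matrix.add_mul]
  have hC := pos (hconv hP hQ ha hb hab)
  rw [hcomb] at hC
  have key := hV.re_trace_mul_nonneg ((pos hP).posSemidef_inv_convex_s8 (pos hQ) ha hb hab hC)
  simp only [hcomb]
  simpa [Matrix.mul_sub, Matrix.mul_add, trace_sub, trace_add, trace_smul] using key
end

section
/- Strict convexity of the regularized MSE term: Let H be an N×M complex matrix with full column rank (rank H = M) and R an N×N Hermitian positive definite complex matrix. The function h(Q) := Re Tr( R (H Q H^H + R)^{-1} ) is strictly convex on the convex set of M×M Hermitian positive semidefinite complex matrices. -/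
open Matrix ComplexOrder

open scoped MatrixOrder in
theorem Matrix.PosDef.exists_isUnit_eq_conjTranspose_mul_self {n : Type*} [Fintype n]
    [DecidableEq n] {A : Matrix n n ℂ} (hA : A.PosDef) :
    ∃ B : Matrix n n ℂ, IsUnit B ∧ A = Bᴴ * B := by
  obtain ⟨B, rfl⟩ := CStarAlgebra.nonneg_iff_eq_star_mul_self.mp hA.posSemidef.nonneg
  refine ⟨B, ?_, rfl⟩
  have h := (isUnit_iff_isUnit_det _).1 hA.isUnit
  rw [det_mul] at h
  exact (isUnit_iff_isUnit_det _).2 (isUnit_of_mul_isUnit_right h)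

/-- For positive definite `R` and `A`, the form `D ↦ Tr(R Dᴴ A D)` is positive definite. -/
theorem Matrix.PosDef.trace_mul_conjTranspose_mul_mul_pos {n : Type*} [Fintype n]
    [DecidableEq n] {R A D : Matrix n n ℂ} (hR : R.PosDef) (hA : A.PosDef) (hD : D ≠ 0) :
    0 < (R * (Dᴴ * A * D)).trace := by
  obtain ⟨L, hL, rfl⟩ := hR.exists_isUnit_eq_conjTranspose_mul_self
  obtain ⟨B, hB, rfl⟩ := hA.exists_isUnit_eq_conjTranspose_mul_self
  have htrace : (Lᴴ * L * (Dᴴ * (Bᴴ * B) * D)).trace = ((B * D * Lᴴ)ᴴ * (B * D * Lᴴ)).trace := by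
    rw [Matrix.mul_assoc Lᴴ, trace_mul_comm]
    simp only [conjTranspose_mul, conjTranspose_conjTranspose, Matrix.mul_assoc]
  rw [htrace]
  refine (posSemidef_conjTranspose_mul_self _).trace_nonneg.lt_of_ne' fun h => hD ?_
  rw [trace_conjTranspose_mul_self_eq_zero_iff] at h
  have hLs : IsUnit Lᴴ := hL.star
  rw [hLs.mul_left_eq_zero] at h
  rwa [hB.mul_right_eq_zero] at h

theorem Matrix.strictConvexOn_re_trace_mul_inv {n : Type*} [Fintype n] [DecidableEq n]
    {R : Matrix n n ℂ} (hR : R.PosDef) :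
    StrictConvexOn ℝ {A : Matrix n n ℂ | A.PosDef} (fun A => ((R * A⁻¹).trace).re) := by
  have hconv : Convex ℝ {A : Matrix n n ℂ | A.PosDef} :=
    convex_iff_forall_pos.2 fun A hA B hB a b ha hb _ =>
      PosDef.add (PosDef.smul hA ha) (PosDef.smul hB hb)
  refine ⟨hconv, fun A hA B hB hAB a b ha hb hab => ?_⟩
  have hC : (a • A + b • B).PosDef := hconv hA hB ha.le hb.le hab
  simp only [Set.mem_ofPred_eq] at hA hB
  set C := a • A + b • B with hCdef
  have hb' : b = 1 - a := by linarith
  have hAu := (isUnit_iff_isUnit_det _).1 hA.isUnit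
  have hBu := (isUnit_iff_isUnit_det _).1 hB.isUnit
  have hCu := (isUnit_iff_isUnit_det _).1 hC.isUnit
  have expand (X : Matrix n n ℂ) (hX : IsUnit X.det) :
      (X⁻¹ - C⁻¹) * X * (X⁻¹ - C⁻¹) = X⁻¹ - 2 • C⁻¹ + C⁻¹ * X * C⁻¹ := by
    rw [Matrix.sub_mul, nonsing_inv_mul _ hX, Matrix.sub_mul, Matrix.mul_sub (C⁻¹ * X),
      Matrix.mul_assoc C⁻¹ X X⁻¹, mul_nonsing_inv _ hX]
    simp only [Matrix.one_mul, Matrix.mul_one]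
    abel
  have hsum : a • (C⁻¹ * A * C⁻¹) + b • (C⁻¹ * B * C⁻¹) = C⁻¹ := by
    calc _ = C⁻¹ * C * C⁻¹ := by
          rw [hCdef, Matrix.mul_add, Matrix.add_mul]
          simp only [Matrix.mul_smul, Matrix.smul_mul]
      _ = C⁻¹ := by rw [nonsing_inv_mul _ hCu, Matrix.one_mul]
  have gap : a • A⁻¹ + b • B⁻¹ = C⁻¹ + (a • ((A⁻¹ - C⁻¹) * A * (A⁻¹ - C⁻¹)) +
      b • ((B⁻¹ - C⁻¹) * B * (B⁻¹ - C⁻¹))) := by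
    rw [expand A hAu, expand B hBu]
    have : a • (A⁻¹ - 2 • C⁻¹ + C⁻¹ * A * C⁻¹) + b • (B⁻¹ - 2 • C⁻¹ + C⁻¹ * B * C⁻¹) =
        a • A⁻¹ + b • B⁻¹ - (a + b) • (2 • C⁻¹) +
          (a • (C⁻¹ * A * C⁻¹) + b • (C⁻¹ * B * C⁻¹)) := by module
    rw [this, hsum, hab]
    module
  have pos (X : Matrix n n ℂ) (hX : X.PosDef) (hne : X ≠ C) :
      0 < ((R * ((X⁻¹ - C⁻¹) * X * (X⁻¹ - C⁻¹))).trace).re := by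
    have hD : (X⁻¹ - C⁻¹)ᴴ = X⁻¹ - C⁻¹ := hX.inv.isHermitian.sub hC.inv.isHermitian
    have hne' : X⁻¹ - C⁻¹ ≠ 0 := fun h => hne <|
      inv_inj (sub_eq_zero.1 h) ((isUnit_iff_isUnit_det _).1 hX.isUnit)
    have := hR.trace_mul_conjTranspose_mul_mul_pos hX hne'
    rw [hD] at this
    exact (Complex.lt_def.1 this).1
  have hAC : A ≠ C := fun h => hAB <| by
    have : b • (A - B) = 0 := by
      rw [smul_sub, sub_eq_zero]
      calc b • A = A - a • A := by rw [hb']; module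
        _ = b • B := by nth_rw 1 [h]; rw [hCdef]; module
    exact sub_eq_zero.1 ((smul_eq_zero.1 this).resolve_left hb.ne')
  have hBC : B ≠ C := fun h => hAB <| by
    have : a • (A - B) = 0 := by
      rw [smul_sub, sub_eq_zero]
      calc a • A = C - b • B := by rw [hCdef]; module
        _ = a • B := by rw [← h, hb']; module
    exact sub_eq_zero.1 ((smul_eq_zero.1 this).resolve_left ha.ne')
  have key := congrArg (fun X => ((R * X).trace).re) gap
  simp only [Matrix.mul_add, Matrix.mul_smul, trace_add, trace_smul, Complex.add_re,
    Complex.smul_re] at key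
  dsimp only
  rw [key]
  have := smul_pos ha (pos A hA hAC)
  have := smul_pos hb (pos B hB hBC)
  linarith

theorem Matrix.mulVec_injective_of_rank_eq_card {m n K : Type*} [Fintype m] [Fintype n] [Field K]
    {A : Matrix m n K} (hA : A.rank = Fintype.card n) : Function.Injective A.mulVec := by
  have h := A.mulVecLin.finrank_range_add_finrank_ker
  rw [Module.finrank_fintype_fun_eq_card, ← hA, Matrix.rank, Nat.add_eq_left,
    Submodule.finrank_eq_zero] at h
  exact LinearMap.ker_eq_bot.1 h

theorem Matrix.mul_mul_conjTranspose_injective {m n : Type*} [Fintype m] [Fintype n]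
    [DecidableEq n] {H : Matrix m n ℂ} (hH : Function.Injective H.mulVec) :
    Function.Injective fun Q : Matrix n n ℂ => H * Q * Hᴴ := by
  intro P Q h
  have hu : IsUnit (Hᴴ * H) := (PosDef.conjTranspose_mul_self H hH).isUnit
  have : (Hᴴ * H) * (P * (Hᴴ * H)) = (Hᴴ * H) * (Q * (Hᴴ * H)) := by
    simpa only [Matrix.mul_assoc] using congrArg (fun X => Hᴴ * X * H) h
  exact hu.mul_right_cancel (hu.mul_left_cancel this)

/-- Strict convexity of the regularized MSE term: if `H` has full column rank, then
`h(Q) = Re Tr(R (H Q Hᴴ + R)⁻¹)` is strictly convex on the set of PSD matrices. -/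
theorem regularized_mse_strictly_convex {N M : ℕ} (H : Matrix (Fin N) (Fin M) ℂ)
    (hH : H.rank = M) (R : Matrix (Fin N) (Fin N) ℂ) (hR : R.PosDef) :
    StrictConvexOn ℝ {Q : Matrix (Fin M) (Fin M) ℂ | Q.PosSemidef}
      (fun Q => ((R * (H * Q * Hᴴ + R)⁻¹).trace).re) := by
  have hinj := mul_mul_conjTranspose_injective
    (mulVec_injective_of_rank_eq_card (hH.trans (Fintype.card_fin M).symm))
  have hpos {Q : Matrix (Fin M) (Fin M) ℂ} (hQ : Q.PosSemidef) : (H * Q * Hᴴ + R).PosDef :=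
    PosDef.posSemidef_add (hQ.mul_mul_conjTranspose_same H) hR
  refine ⟨fun P hP Q hQ a b ha hb _ => PosSemidef.add (PosSemidef.smul hP ha)
    (PosSemidef.smul hQ hb), fun P hP Q hQ hPQ a b ha hb hab => ?_⟩
  have hne : H * P * Hᴴ + R ≠ H * Q * Hᴴ + R := fun h => hPQ (hinj (add_right_cancel h))
  have haff : H * (a • P + b • Q) * Hᴴ + R = a • (H * P * Hᴴ + R) + b • (H * Q * Hᴴ + R) := by
    calc _ = a • (H * P * Hᴴ) + b • (H * Q * Hᴴ) + (a + b) • R := by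
          simp only [Matrix.mul_add, Matrix.add_mul, Matrix.mul_smul, Matrix.smul_mul, hab,
            one_smul]
      _ = _ := by module
  dsimp only
  rw [haff]
  exact (strictConvexOn_re_trace_mul_inv hR).2 (hpos hP) (hpos hQ) hne ha hb hab
end

section
/- Second derivative of the trace-of-inverse along a line: Let H be an N×M complex matrix, R an N×N Hermitian positive definite complex matrix, X an M×M Hermitian positive semidefinite complex matrix, and Y an M×M Hermitian complex matrix. For t in an open interval on which X + tY is Hermitian positive semidefinite, define J(t) := Re Tr( R (H(X + tY)H^H + R)^{-1} ). Then J is twice differentiable at each such t, with second derivative J''(t) = 2·Re Tr( C R C L C L ), where C := (R + H(X + tY)H^H)^{-1} and L := H Y H^H. -/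
open Matrix ComplexOrder

section Calculus

attribute [local instance] Matrix.linftyOpNormedRing Matrix.linftyOpNormedAlgebra

variable {n : Type*} [Fintype n] [DecidableEq n]

/-- Derivative of the inverse of a matrix depending affinely on a real parameter. -/
theorem hasDerivAt_matrix_inv_add_smul (P L : Matrix n n ℂ) (t : ℝ) (h : IsUnit (P + t • L)) :
    HasDerivAt (fun s : ℝ => (P + s • L)⁻¹) (-((P + t • L)⁻¹ * L * (P + t • L)⁻¹)) t := by
  obtain ⟨u, hu⟩ := h
  have hline : HasDerivAt (fun s : ℝ => P + s • L) L t := by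
    have h := ((hasDerivAt_id t).smul_const L).const_add P
    rw [one_smul] at h
    exact h
  have hinv := hasFDerivAt_ringInverse (𝕜 := ℝ) u
  rw [hu] at hinv
  have hcomp := hinv.comp_hasDerivAt t hline
  have hcoe : ((u⁻¹ : (Matrix n n ℂ)ˣ) : Matrix n n ℂ) = (P + t • L)⁻¹ := by
    rw [← hu, Matrix.coe_units_inv]
  simp only [Function.comp_def, ← Matrix.nonsing_inv_eq_ringInverse, hcoe] at hcomp
  exact hcomp

/-- The real part of the trace against a fixed matrix commutes with differentiation. -/
theorem HasDerivAt.re_trace_mul {F : ℝ → Matrix n n ℂ} {F' : Matrix n n ℂ} {t : ℝ}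
    (hF : HasDerivAt F F' t) (R : Matrix n n ℂ) :
    HasDerivAt (fun s => ((R * F s).trace).re) ((R * F').trace).re t := by
  have hmul := hF.const_mul R
  exact ((Complex.reLm ∘ₗ Matrix.traceLinearMap n ℝ ℂ).toContinuousLinearMap.hasFDerivAt
    ).comp_hasDerivAt t hmul

/-- First derivative of the weighted trace of the inverse along an affine line of matrices. -/
theorem hasDerivAt_re_trace_mul_inv (R P L : Matrix n n ℂ) (t : ℝ) (h : IsUnit (P + t • L)) :
    HasDerivAt (fun s : ℝ => ((R * (P + s • L)⁻¹).trace).re)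
      ((R * -((P + t • L)⁻¹ * L * (P + t • L)⁻¹)).trace).re t :=
  (hasDerivAt_matrix_inv_add_smul P L t h).re_trace_mul R

/-- Derivative of the first derivative of the weighted trace of the inverse along a line. -/
theorem hasDerivAt_re_trace_mul_neg_inv_mul_inv (R P L : Matrix n n ℂ) (t : ℝ)
    (h : IsUnit (P + t • L)) :
    HasDerivAt (fun s : ℝ => ((R * -((P + s • L)⁻¹ * L * (P + s • L)⁻¹)).trace).re)
      (2 * (((P + t • L)⁻¹ * R * (P + t • L)⁻¹ * L * (P + t • L)⁻¹ * L).trace).re) t := by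
  have hinv := hasDerivAt_matrix_inv_add_smul P L t h
  have hder := ((hinv.mul_const L).mul hinv).neg.re_trace_mul R
  refine hder.congr_deriv ?_
  have hcyc (C : Matrix n n ℂ) :
      (C * R * C * L * C * L).trace = (R * (C * L * C * L * C)).trace := by
    rw [show C * R * C * L * C * L = C * (R * (C * L * C * L)) by noncomm_ring,
      Matrix.trace_mul_comm]
    noncomm_ring
  rw [hcyc, show ∀ C : Matrix n n ℂ, R * -(-(C * L * C) * L * C + C * L * -(C * L * C)) =
      R * (C * L * C * L * C) + R * (C * L * C * L * C) by intro C; noncomm_ring]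
  rw [Matrix.trace_add, Complex.add_re, two_mul]

end Calculus

/-- Second derivative of the trace-of-inverse along a line: for `t` in an open interval
on which `X + tY` is PSD, `J(t) = Re Tr(R (H(X+tY)Hᴴ + R)⁻¹)` is twice differentiable
with `J''(t) = 2 Re Tr(C R C L C L)`, where `C = (R + H(X+tY)Hᴴ)⁻¹`, `L = H Y Hᴴ`. -/
theorem second_derivative_trace_inverse {N M : ℕ} (H : Matrix (Fin N) (Fin M) ℂ)
    (R : Matrix (Fin N) (Fin N) ℂ) (hR : R.PosDef)
    (X Y : Matrix (Fin M) (Fin M) ℂ) (hX : X.PosSemidef) (hY : Y.IsHermitian)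
    (a b : ℝ) (hPSD : ∀ t ∈ Set.Ioo a b, (X + t • Y).PosSemidef) :
    ∀ t ∈ Set.Ioo a b,
      DifferentiableAt ℝ
        (fun s : ℝ => ((R * (H * (X + s • Y) * Hᴴ + R)⁻¹).trace).re) t ∧
      HasDerivAt
        (deriv (fun s : ℝ => ((R * (H * (X + s • Y) * Hᴴ + R)⁻¹).trace).re))
        (2 * (((R + H * (X + t • Y) * Hᴴ)⁻¹ * R * (R + H * (X + t • Y) * Hᴴ)⁻¹ *
          (H * Y * Hᴴ) * (R + H * (X + t • Y) * Hᴴ)⁻¹ * (H * Y * Hᴴ)).trace).re) t := by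
  intro t ht
  have hline (s : ℝ) : R + H * (X + s • Y) * Hᴴ = R + H * X * Hᴴ + s • (H * Y * Hᴴ) := by
    simp [Matrix.mul_add, Matrix.add_mul, add_assoc]
  have hunit : ∀ s ∈ Set.Ioo a b, IsUnit (R + H * X * Hᴴ + s • (H * Y * Hᴴ)) := by
    intro s hs
    have hpd := hR.add_posSemidef ((hPSD s hs).mul_mul_conjTranspose_same H)
    exact hline s ▸ hpd.isUnit
  simp only [add_comm _ R, hline]
  refine ⟨(hasDerivAt_re_trace_mul_inv R _ _ t (hunit t ht)).differentiableAt, ?_⟩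
  refine (hasDerivAt_re_trace_mul_neg_inv_mul_inv R _ _ t (hunit t ht)).congr_of_eventuallyEq ?_
  filter_upwards [isOpen_Ioo.mem_nhds ht] with s hs
  exact (hasDerivAt_re_trace_mul_inv R _ _ s (hunit s hs)).deriv
end

section
/- Strict convexity of the spectral function Tr((I+X)^{-1}): The function g(X) := Re Tr( (I_n + X)^{-1} ) is strictly convex on the convex set of n×n Hermitian positive semidefinite complex matrices: for all Hermitian PSD X₁ ≠ X₂ and 0 < λ < 1, g(λX₁ + (1−λ)X₂) < λg(X₁) + (1−λ)g(X₂). -/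
open Matrix ComplexOrder

/-- If `X` is positive semidefinite and `D ≠ 0`, then `Dᴴ (1 + X) D` has positive trace. -/
lemma Matrix.PosSemidef.trace_conjTranspose_mul_one_add_mul_pos {ι : Type*} [Fintype ι]
    [DecidableEq ι] {X D : Matrix ι ι ℂ} (hX : X.PosSemidef) (hD : D ≠ 0) :
    0 < (Dᴴ * (1 + X) * D).trace := by
  have h₁ : 0 < (Dᴴ * D).trace :=
    lt_of_le_of_ne (posSemidef_conjTranspose_mul_self D).trace_nonneg
      fun h => hD (trace_conjTranspose_mul_self_eq_zero_iff.1 h.symm)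
  have h₂ : 0 ≤ (Dᴴ * X * D).trace := (hX.conjTranspose_mul_mul_same D).trace_nonneg
  rw [Matrix.mul_add, Matrix.mul_one, Matrix.add_mul, trace_add]
  exact add_pos_of_pos_of_nonneg h₁ h₂

/-- The graph of `X ↦ Re Tr((1 + X)⁻¹)` lies strictly above its tangent at `Z`. -/
lemma Matrix.PosSemidef.re_trace_inv_one_add_gt_tangent {ι : Type*} [Fintype ι]
    [DecidableEq ι] {X Z : Matrix ι ι ℂ} (hX : X.PosSemidef) (hZ : Z.PosSemidef)
    (hne : X ≠ Z) :
    2 * ((1 + Z)⁻¹.trace).re - (((1 + Z)⁻¹ * (1 + X) * (1 + Z)⁻¹).trace).re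
      < ((1 + X)⁻¹.trace).re := by
  have hA : (1 + X).PosDef := PosDef.one.add_posSemidef hX
  have hC : (1 + Z).PosDef := PosDef.one.add_posSemidef hZ
  have hAu := (isUnit_iff_isUnit_det _).1 hA.isUnit
  have hCu := (isUnit_iff_isUnit_det _).1 hC.isUnit
  have hD : (1 + X)⁻¹ - (1 + Z)⁻¹ ≠ 0 := fun h =>
    hne (add_left_cancel (inv_inj (sub_eq_zero.1 h) hAu))
  have hpos := hX.trace_conjTranspose_mul_one_add_mul_pos hD
  rw [conjTranspose_sub, hA.inv.isHermitian.eq, hC.inv.isHermitian.eq, Matrix.sub_mul,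
    nonsing_inv_mul _ hAu, Matrix.sub_mul, Matrix.one_mul, Matrix.mul_sub,
    Matrix.mul_assoc _ (1 + X) (1 + X)⁻¹, mul_nonsing_inv _ hAu, Matrix.mul_one] at hpos
  have := (Complex.lt_def.1 hpos).1
  simp only [trace_sub, Complex.sub_re, Complex.zero_re] at this
  linarith

/-- Strict convexity of the spectral function `g(X) = Re Tr((I + X)⁻¹)` on the convex
set of Hermitian positive semidefinite matrices. -/
theorem trace_inv_one_add_strictly_convex {n : ℕ} :
    StrictConvexOn ℝ {X : Matrix (Fin n) (Fin n) ℂ | X.PosSemidef}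
      (fun X => (((1 + X)⁻¹).trace).re) := by
  have hconv : Convex ℝ {X : Matrix (Fin n) (Fin n) ℂ | X.PosSemidef} :=
    fun X hX Y hY a b ha hb _ => PosSemidef.add (PosSemidef.smul hX ha) (PosSemidef.smul hY hb)
  refine ⟨hconv, fun X hX Y hY hne a b ha hb hab => ?_⟩
  have hZ := hconv hX hY ha.le hb.le hab
  have hXZ : X ≠ a • X + b • Y := fun h => hne <| by
    have h' : b • X = b • Y := by
      rw [← add_right_inj (a • X), ← add_smul, hab, one_smul]; exact h
    exact smul_right_injective _ hb.ne' h'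
  have hYZ : Y ≠ a • X + b • Y := fun h => hne <| by
    have h' : a • X = a • Y := by
      rw [← add_left_inj (b • Y), ← add_smul, hab, one_smul]; exact h.symm
    exact smul_right_injective _ ha.ne' h'
  have h₁ := PosSemidef.re_trace_inv_one_add_gt_tangent hX hZ hXZ
  have h₂ := PosSemidef.re_trace_inv_one_add_gt_tangent hY hZ hYZ
  have hsum : a • (1 + X) + b • (1 + Y) = 1 + (a • X + b • Y) := by
    rw [smul_add, smul_add, add_add_add_comm, ← add_smul, hab, one_smul]
  have hCu := (isUnit_iff_isUnit_det _).1 (PosDef.one.add_posSemidef hZ).isUnit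
  generalize a • X + b • Y = Z at *
  have key : a * (((1 + Z)⁻¹ * (1 + X) * (1 + Z)⁻¹).trace).re
      + b * (((1 + Z)⁻¹ * (1 + Y) * (1 + Z)⁻¹).trace).re = ((1 + Z)⁻¹.trace).re := by
    have h : a • ((1 + Z)⁻¹ * (1 + X) * (1 + Z)⁻¹) + b • ((1 + Z)⁻¹ * (1 + Y) * (1 + Z)⁻¹)
        = (1 + Z)⁻¹ := by
      calc
        _ = (1 + Z)⁻¹ * (a • (1 + X) + b • (1 + Y)) * (1 + Z)⁻¹ := by
          simp only [Matrix.mul_add, Matrix.add_mul, Matrix.mul_smul, Matrix.smul_mul]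
        _ = (1 + Z)⁻¹ := by rw [hsum, nonsing_inv_mul _ hCu, Matrix.one_mul]
    simpa [trace_add, trace_smul] using congrArg (fun M => (trace M).re) h
  simp only [smul_eq_mul]
  have hb' : b = 1 - a := by linarith
  subst hb'
  nlinarith [mul_lt_mul_of_pos_left h₁ ha, mul_lt_mul_of_pos_left h₂ hb]
end
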